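/- arXiv:2307.11372 — 2 statements merged into one kernel-verified Lean document; each statement's English description precedes it below -/
import Mathlib

section
/- Let Φ : 𝒫_ℚ → 𝒫 be a support-preserving multiplicative map. Then there exists a real constant γ > 0 such that for every rational a > 0, Φ[(X+a)/(1+a)] = (X+γa)/(1+γa). -/
open Polynomial

/-- `Pset` is the set of real polynomials with nonnegative coefficients summing to 1. -/
def Pset : Set (Polynomial ℝ) := {p | (∀ k, 0 ≤ p.coeff k) ∧ p.eval 1 = 1}

/-- `PQset` is the subset of `Pset` of polynomials with rational coefficients. -/
def PQset : Set (Polynomial ℝ) := {p | p ∈ Pset ∧ ∀ k : ℕ, ∃ r : ℚ, p.coeff k = (r : ℝ)}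

/-- The normalized linear polynomial `(X + a)/(1 + a)`. -/
noncomputable def lin (a : ℝ) : Polynomial ℝ := C (1 + a)⁻¹ * (X + C a)

/-- If the increments of an increasing function `f` at every base point `b` scale by a factor `H b s`
when the step is scaled by `s`, then comparing growth rates shows `H b s ≤ H c s` for `1 < s`. -/
lemma increment_scaling_le {f : ℚ → ℝ} {H : ℚ → ℚ → ℝ}
    (hmono : ∀ b d, 0 < b → b < d → f b < f d)
    (hH : ∀ b s u, 0 < b → 0 < s → 0 < u →
      f (b + s * u) - f b = H b s * (f (b + u) - f b))
    {b c s : ℚ} (hb : 0 < b) (hc : 0 < c) (hs : 1 < s) : H b s ≤ H c s := by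
  have hs0 : 0 < s := by linarith
  have hD : ∀ b u, 0 < b → 0 < u → 0 < f (b + u) - f b := fun b u hb hu => by
    have := hmono b (b + u) hb (by linarith)
    linarith
  have hone : ∀ b, 0 < b → 1 < H b s := fun b hb => by
    have h1 := hH b s 1 hb hs0 one_pos
    have h2 := hD b 1 hb one_pos
    have h3 := hmono (b + 1) (b + s * 1) (by linarith) (by linarith)
    by_contra! h
    nlinarith
  have hpow : ∀ b u, 0 < b → 0 < u → ∀ n : ℕ,
      f (b + s ^ n * u) - f b = H b s ^ n * (f (b + u) - f b) := fun b u hb hu n => by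
    induction n with
    | zero => simp
    | succ n ih =>
      rw [pow_succ', pow_succ', mul_assoc, hH b s _ hb hs0 (by positivity), ih, mul_assoc]
  by_contra! hlt
  have hc1 := hone c hc
  have hratio : 1 < H b s / H c s := by rwa [one_lt_div (by linarith)]
  set K : ℝ := |f c - f b| + (f (c + (1 + b)) - f c)
  obtain ⟨n, hn⟩ := pow_unbounded_of_one_lt (K / (f (b + 1) - f b)) hratio
  have hD1 := hD b 1 hb one_pos
  have hcn : 1 ≤ H c s ^ n := one_le_pow₀ hc1.le
  rw [div_lt_iff₀ hD1, div_pow, div_mul_eq_mul_div, lt_div_iff₀ (by linarith)] at hn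
  have e1 := hpow b 1 hb one_pos n
  have e2 := hpow c (1 + b) hc (by linarith) n
  have hsn : 1 ≤ s ^ n := one_le_pow₀ hs.le
  have hle := hmono (b + s ^ n * 1) (c + s ^ n * (1 + b)) (by positivity) (by nlinarith)
  have habs := le_abs_self (f c - f b)
  have habs0 := abs_nonneg (f c - f b)
  simp only [K] at hn
  nlinarith

/-- A positive multiplicative function on the positive rationals that satisfies
`m (1 + t) = 1 + m t` is the identity. -/
lemma eq_cast_of_mul_of_one_add {m : ℚ → ℝ} (hpos : ∀ a, 0 < a → 0 < m a)
    (hmul : ∀ a b, 0 < a → 0 < b → m (a * b) = m a * m b)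
    (hadd : ∀ t, 0 < t → m (1 + t) = 1 + m t) {a : ℚ} (ha : 0 < a) : m a = a := by
  have h1 : m 1 = 1 := by
    have h := hmul 1 1 one_pos one_pos
    have := hpos 1 one_pos
    rw [mul_one] at h
    nlinarith
  have hnat : ∀ n : ℕ, m (n + 1) = n + 1 := fun n => by
    induction n with
    | zero => simp [h1]
    | succ n ih =>
      rw [add_comm, hadd _ (by positivity)]
      push_cast
      rw [ih]
      ring
  have hnat' : ∀ n : ℕ, 0 < n → m n = n := fun n hn => by
    obtain ⟨k, rfl⟩ := Nat.exists_eq_succ_of_ne_zero hn.ne'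
    have := hnat k
    push_cast
    exact this
  have hden : (0 : ℚ) < a.den := by exact_mod_cast a.den_pos
  have hnum : 0 < a.num := Rat.num_pos.2 ha
  have hnn : ((a.num.toNat : ℕ) : ℚ) = (a.num : ℚ) := by
    exact_mod_cast congrArg (Int.cast : ℤ → ℚ) (Int.toNat_of_nonneg hnum.le)
  have hq : a * a.den = (a.num.toNat : ℚ) := by rw [hnn, Rat.mul_den_eq_num]
  have h := hmul a a.den ha hden
  rw [hq, hnat' _ (by omega), hnat' _ a.den_pos] at h
  have hq' : (a : ℝ) * a.den = (a.num.toNat : ℝ) := by exact_mod_cast hq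
  have hden' : (0 : ℝ) < a.den := by exact_mod_cast a.den_pos
  exact mul_right_cancel₀ hden'.ne' (h.symm.trans hq'.symm)

/-- A positive increasing function on the positive rationals that satisfies
`(f (b (1 + s t)) - f b) f b = (f b - f (b (1 - s))) (f (b (1 + t)) - f b)` is linear. -/
lemma eq_mul_of_increment_relation {f : ℚ → ℝ} (hpos : ∀ a, 0 < a → 0 < f a)
    (hmono : ∀ b d, 0 < b → b < d → f b < f d)
    (hrel : ∀ b s t, 0 < b → 0 < s → s < 1 → 0 < t →
      (f (b * (1 + s * t)) - f b) * f b
        = (f b - f (b * (1 - s))) * (f (b * (1 + t)) - f b))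
    {a : ℚ} (ha : 0 < a) : f a = f 1 * a := by
  have hD : ∀ b u, 0 < b → 0 < u → 0 < f (b + u) - f b := fun b u hb hu => by
    have := hmono b (b + u) hb (by linarith)
    linarith
  have hscale : ∀ b s u, 0 < b → 0 < s → s < 1 → 0 < u →
      (f (b + s * u) - f b) * f b = (f b - f (b * (1 - s))) * (f (b + u) - f b) := by
    intro b s u hb hs hs1 hu
    have h := hrel b s (u / b) hb hs hs1 (by positivity)
    have e1 : b * (1 + s * (u / b)) = b + s * u := by field_simp
    have e2 : b * (1 + u / b) = b + u := by field_simp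
    rwa [e1, e2] at h
  set H : ℚ → ℚ → ℝ := fun b s => (f (b + s) - f b) / (f (b + 1) - f b) with hHdef
  have hHpos : ∀ b s, 0 < b → 0 < s → 0 < H b s := fun b s hb hs =>
    div_pos (hD b s hb hs) (hD b 1 hb one_pos)
  have hHsmall : ∀ b s, 0 < b → 0 < s → s < 1 → f b - f (b * (1 - s)) = f b * H b s := by
    intro b s hb hs hs1
    have h := hscale b s 1 hb hs hs1 one_pos
    have h1 := hD b 1 hb one_pos
    rw [mul_one] at h
    simp only [hHdef]
    field_simp
    linarith
  have hHlt : ∀ b s u, 0 < b → 0 < s → s < 1 → 0 < u →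
      f (b + s * u) - f b = H b s * (f (b + u) - f b) := by
    intro b s u hb hs hs1 hu
    have h := hscale b s u hb hs hs1 hu
    rw [hHsmall b s hb hs hs1] at h
    have := hpos b hb
    apply mul_right_cancel₀ this.ne'
    linarith
  have hH : ∀ b s u, 0 < b → 0 < s → 0 < u →
      f (b + s * u) - f b = H b s * (f (b + u) - f b) := by
    intro b s u hb hs hu
    rcases lt_trichotomy s 1 with hs1 | rfl | hs1
    · exact hHlt b s u hb hs hs1 hu
    · have := hD b 1 hb one_pos
      simp only [hHdef, one_mul]
      field_simp
    · have hi : s⁻¹ < 1 := inv_lt_one_of_one_lt₀ hs1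
      have h1 := hHlt b s⁻¹ (s * u) hb (by positivity) hi (by positivity)
      have h2 := hHlt b s⁻¹ s hb (by positivity) hi hs
      rw [inv_mul_cancel_left₀ hs.ne'] at h1
      rw [inv_mul_cancel₀ hs.ne'] at h2
      have h3 := hHpos b s⁻¹ hb (by positivity)
      have h4 := hD b 1 hb one_pos
      have h5 : f (b + s) - f b = H b s * (f (b + 1) - f b) := by
        simp only [hHdef]
        field_simp
      rw [h5] at h2
      have h6 : H b s⁻¹ * H b s = 1 := by
        apply mul_right_cancel₀ h4.ne'
        linarith
      rw [h1, ← mul_assoc, mul_comm (H b s), h6, one_mul]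
  have hHmul : ∀ s u, 0 < s → 0 < u → H 1 (s * u) = H 1 s * H 1 u := by
    intro s u hs hu
    have h := hH 1 s u one_pos hs hu
    change _ / _ = H 1 s * (_ / _)
    rw [h, mul_div_assoc]
  have hHone : ∀ b, 0 < b → H b 1 = 1 := fun b hb => div_self (hD b 1 hb one_pos).ne'
  have hHinv : ∀ b s, 0 < b → 0 < s → H b s⁻¹ * H b s = 1 := by
    intro b s hb hs
    have h := hH b s⁻¹ s hb (by positivity) hs
    have h4 := hD b 1 hb one_pos
    rw [inv_mul_cancel₀ hs.ne'] at h
    simp only [hHdef] at h ⊢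
    rw [← mul_div_assoc, ← h, div_self h4.ne']
  have hindep : ∀ b s, 0 < b → 0 < s → s < 1 → H b s = H 1 s := by
    intro b s hb hs hs1
    have hi : 1 < s⁻¹ := (one_lt_inv₀ hs).2 hs1
    have h := le_antisymm (increment_scaling_le hmono hH hb one_pos hi)
      (increment_scaling_le hmono hH one_pos hb hi)
    have h1 := hHinv b s hb hs
    have h2 := hHinv 1 s one_pos hs
    rw [h] at h1
    exact mul_left_cancel₀ (hHpos 1 s⁻¹ one_pos (by positivity)).ne' (h1.trans h2.symm)
  have hf1 := hpos 1 one_pos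
  set m : ℚ → ℝ := fun x => f x / f 1 with hm
  have hfm : ∀ x, f x = f 1 * m x := fun x => by
    simp only [hm]
    field_simp
  have hmpos : ∀ x, 0 < x → 0 < m x := fun x hx => div_pos (hpos x hx) hf1
  have hm1 : m 1 = 1 := div_self hf1.ne'
  have hmH : ∀ s, 0 < s → s < 1 → m (1 - s) = 1 - H 1 s := by
    intro s hs hs1
    have h := hHsmall 1 s one_pos hs hs1
    rw [one_mul, hfm (1 - s)] at h
    apply mul_left_cancel₀ hf1.ne'
    linarith
  have hmul_lt : ∀ b x, 0 < b → 0 < x → x < 1 → m (b * x) = m b * m x := by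
    intro b x hb hx hx1
    have h := hHsmall b (1 - x) hb (by linarith) (by linarith)
    have h2 := hmH (1 - x) (by linarith) (by linarith)
    rw [hindep b _ hb (by linarith) (by linarith)] at h
    rw [sub_sub_cancel] at h h2
    rw [hfm b, hfm (b * x)] at h
    apply mul_left_cancel₀ hf1.ne'
    rw [h2]
    linarith
  have hminv : ∀ x, 1 < x → m x * m x⁻¹ = 1 := fun x hx => by
    rw [← hmul_lt x x⁻¹ (by linarith) (by positivity) (inv_lt_one_of_one_lt₀ hx),
      mul_inv_cancel₀ (by linarith), hm1]
  have hmmul : ∀ b x, 0 < b → 0 < x → m (b * x) = m b * m x := by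
    intro b x hb hx
    rcases lt_trichotomy x 1 with hx1 | rfl | hx1
    · exact hmul_lt b x hb hx hx1
    · rw [mul_one, hm1, mul_one]
    · have h := hmul_lt (b * x) x⁻¹ (by positivity) (by positivity) (inv_lt_one_of_one_lt₀ hx1)
      rw [mul_inv_cancel_right₀ hx.ne'] at h
      rw [h, mul_assoc, mul_comm (m x⁻¹), hminv x hx1, mul_one]
  set κ : ℝ := m 2 - 1 with hκ
  have hmadd : ∀ t, 0 < t → m (1 + t) = 1 + κ * H 1 t := by
    intro t ht
    have h1 := hD 1 1 one_pos one_pos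
    simp only [hκ, hm, hHdef]
    norm_num at h1 ⊢
    have : f 2 - f 1 ≠ 0 := by linarith
    field_simp
    ring
  have hκpos : 0 < κ := by
    have := hmono 1 2 one_pos (by norm_num)
    rw [hκ, sub_pos, hm]
    exact (one_lt_div hf1).2 this
  have hmκ : ∀ t, 0 < t → m (1 + t) = κ * H 1 (1 + t) := by
    intro t ht
    have h1 := hmadd t ht
    have hx : 0 < t * (1 + t)⁻¹ := by positivity
    have hx1 : t * (1 + t)⁻¹ < 1 := by
      rw [← div_eq_mul_inv, div_lt_one (by linarith)]
      linarith
    have h2 := hmH _ hx hx1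
    have e : 1 - t * (1 + t)⁻¹ = (1 + t)⁻¹ := by
      field_simp
      ring
    rw [e, hHmul t _ ht (by positivity)] at h2
    have h3 := hminv (1 + t) (by linarith)
    have h4 := hHinv 1 (1 + t) one_pos (by linarith)
    have h5 := hHpos 1 t one_pos ht
    rw [h2] at h3
    have h6 : κ * H 1 t = m (1 + t) * H 1 (1 + t)⁻¹ * H 1 t := by linarith
    have h7 := mul_right_cancel₀ h5.ne' h6
    rw [h7, mul_assoc, h4, mul_one]
  have hκ1 : κ = 1 := by
    have h2 := hmκ 1 one_pos
    have h4 := hmκ 3 (by norm_num)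
    norm_num at h2 h4
    have e : (4 : ℚ) = 2 * 2 := by norm_num
    rw [e, hmmul 2 2 (by norm_num) (by norm_num), hHmul 2 2 (by norm_num) (by norm_num), h2] at h4
    have h5 := hHpos 1 2 one_pos (by norm_num)
    have h6 : κ * (κ * (H 1 2 * H 1 2)) = 1 * (κ * (H 1 2 * H 1 2)) := by linarith
    exact mul_right_cancel₀ (by positivity) h6
  have hmeqH : ∀ t, 0 < t → m t = H 1 t := by
    have hgt : ∀ t, 1 < t → m t = H 1 t := fun t ht => by
      have h := hmκ (t - 1) (by linarith)
      rwa [hκ1, one_mul, add_sub_cancel] at h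
    intro t ht
    rcases lt_trichotomy t 1 with h1 | rfl | h1
    · have hi : 1 < t⁻¹ := (one_lt_inv₀ ht).2 h1
      have h2 := hminv _ hi
      have h3 := hHinv 1 t one_pos ht
      rw [inv_inv, hgt _ hi] at h2
      exact mul_left_cancel₀ (hHpos 1 t⁻¹ one_pos (by positivity)).ne' (h2.trans h3.symm)
    · rw [hm1, hHone 1 one_pos]
    · exact hgt t h1
  rw [hfm, eq_cast_of_mul_of_one_add hmpos hmmul (fun t ht => by
    rw [hmadd t ht, hκ1, one_mul, hmeqH t ht]) ha]

/-- The real polynomial obtained from a rational one by scaling its value at `1` to `1`. -/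
noncomputable def normalizedMap (q : ℚ[X]) : ℝ[X] :=
  C ((q.eval 1 : ℚ) : ℝ)⁻¹ * q.map (algebraMap ℚ ℝ)

lemma normalizedMap_mul (p q : ℚ[X]) :
    normalizedMap (p * q) = normalizedMap p * normalizedMap q := by
  simp only [normalizedMap, eval_mul, Rat.cast_mul, mul_inv, Polynomial.map_mul, C_mul]
  ring

lemma normalizedMap_X_add_C (a : ℚ) : normalizedMap (X + C a) = lin a := by
  simp [normalizedMap, lin]

lemma coeff_normalizedMap (q : ℚ[X]) (k : ℕ) :
    (normalizedMap q).coeff k = (((q.eval 1)⁻¹ * q.coeff k : ℚ) : ℝ) := by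
  simp [normalizedMap]

lemma normalizedMap_mem {q : ℚ[X]} (hq : ∀ k, 0 ≤ q.coeff k) (h1 : 0 < q.eval 1) :
    normalizedMap q ∈ PQset := by
  refine ⟨⟨fun k => ?_, ?_⟩, fun k => ⟨_, coeff_normalizedMap q k⟩⟩
  · rw [coeff_normalizedMap]
    have := hq k
    positivity
  · have h : (q.map (algebraMap ℚ ℝ)).eval 1 = ((q.eval 1 : ℚ) : ℝ) := eval_one_map _ q
    have h1' : ((q.eval 1 : ℚ) : ℝ) ≠ 0 := by exact_mod_cast h1.ne'
    rw [normalizedMap, eval_mul, eval_C, h, inv_mul_cancel₀ h1']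

lemma coeff_normalizedMap_pos {q : ℚ[X]} (h1 : 0 < q.eval 1) (k : ℕ) :
    0 < (normalizedMap q).coeff k ↔ 0 < q.coeff k := by
  rw [coeff_normalizedMap, Rat.cast_pos, mul_pos_iff_of_pos_left (inv_pos.2 h1)]

lemma coeff_succ_mul_X_add_C {R : Type*} [CommSemiring R] (p : R[X]) (a : R) (n : ℕ) :
    (p * (X + C a)).coeff (n + 1) = p.coeff n + p.coeff (n + 1) * a := by
  rw [mul_add, coeff_add, coeff_mul_X, coeff_mul_C]

lemma coeff_zero_mul_X_add_C {R : Type*} [CommSemiring R] (p : R[X]) (a : R) :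
    (p * (X + C a)).coeff 0 = p.coeff 0 * a := by
  simp [mul_add]

/-- A polynomial in `Pset` with support `{0, 1}` is a normalized linear polynomial. -/
lemma eq_lin_of_coeff {p : ℝ[X]} (hp : p.eval 1 = 1) (h0 : 0 < p.coeff 0) (h1 : 0 < p.coeff 1)
    (h : ∀ k, p.coeff (k + 2) = 0) : p = lin (p.coeff 0 / p.coeff 1) := by
  have hpe : p = C (p.coeff 1) * X + C (p.coeff 0) := by
    ext k
    rcases k with _ | _ | k
    · simp
    · simp
    · simp [h]
  have hs : p.coeff 1 + p.coeff 0 = 1 := by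
    rw [hpe] at hp
    simpa using hp
  have e : (1 + p.coeff 0 / p.coeff 1)⁻¹ = p.coeff 1 := by
    field_simp
    linarith
  rw [lin, e, mul_add, ← C_mul, mul_div_cancel₀ _ h1.ne']
  exact hpe

/-- The polynomial of degree at most four with the given coefficients. -/
noncomputable def quartic {R : Type*} [Semiring R] (c₀ c₁ c₂ c₃ c₄ : R) : R[X] :=
  C c₀ + C c₁ * X + C c₂ * X ^ 2 + C c₃ * X ^ 3 + C c₄ * X ^ 4

section quartic

variable {R : Type*} [Semiring R] (c₀ c₁ c₂ c₃ c₄ : R)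

@[simp] lemma coeff_zero_quartic : (quartic c₀ c₁ c₂ c₃ c₄).coeff 0 = c₀ := by
  simp [quartic]

@[simp] lemma coeff_one_quartic : (quartic c₀ c₁ c₂ c₃ c₄).coeff 1 = c₁ := by
  simp [quartic, coeff_X_pow, coeff_C]

@[simp] lemma coeff_two_quartic : (quartic c₀ c₁ c₂ c₃ c₄).coeff 2 = c₂ := by
  simp [quartic, coeff_X_pow]

@[simp] lemma coeff_three_quartic : (quartic c₀ c₁ c₂ c₃ c₄).coeff 3 = c₃ := by
  simp [quartic, coeff_X_pow]

@[simp] lemma coeff_four_quartic : (quartic c₀ c₁ c₂ c₃ c₄).coeff 4 = c₄ := by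
  simp [quartic, coeff_X_pow]

@[simp] lemma coeff_add_five_quartic (k : ℕ) : (quartic c₀ c₁ c₂ c₃ c₄).coeff (k + 5) = 0 := by
  simp [quartic]

lemma coeff_add_four_quartic_zero (k : ℕ) : (quartic c₀ c₁ c₂ c₃ 0).coeff (k + 4) = 0 := by
  rcases k with _ | k <;> simp

lemma eval_one_quartic : (quartic c₀ c₁ c₂ c₃ c₄).eval 1 = c₀ + c₁ + c₂ + c₃ + c₄ := by
  simp [quartic]

end quartic

lemma coeff_quartic_nonneg {c₀ c₁ c₂ c₃ c₄ : ℚ} (h₀ : 0 ≤ c₀) (h₁ : 0 ≤ c₁) (h₂ : 0 ≤ c₂)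
    (h₃ : 0 ≤ c₃) (h₄ : 0 ≤ c₄) (k : ℕ) : 0 ≤ (quartic c₀ c₁ c₂ c₃ c₄).coeff k := by
  rcases k with _ | _ | _ | _ | _ | k <;> simp [*]

lemma coeff_mul_nonneg {p q : ℚ[X]} (hp : ∀ k, 0 ≤ p.coeff k) (hq : ∀ k, 0 ≤ q.coeff k) (k : ℕ) :
    0 ≤ (p * q).coeff k := by
  rw [coeff_mul]
  exact Finset.sum_nonneg fun x _ => mul_nonneg (hp _) (hq _)

/-- The cubic `(X² - bX + bd)(X + b)` has no quadratic term. -/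
lemma quadratic_mul_X_add_C_left {R : Type*} [CommRing R] (b d : R) :
    (X ^ 2 - C b * X + C (b * d)) * (X + C b) = quartic (d * b ^ 2) ((d - b) * b) 0 1 0 := by
  simp only [quartic, C_mul, C_sub, C_pow, C_0, C_1]
  ring

/-- The cubic `(X² - bX + bd)(X + d)` has no linear term. -/
lemma quadratic_mul_X_add_C_right {R : Type*} [CommRing R] (b d : R) :
    (X ^ 2 - C b * X + C (b * d)) * (X + C d) = quartic (b * d ^ 2) 0 (d - b) 1 0 := by
  simp only [quartic, C_mul, C_sub, C_pow, C_0, C_1]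
  ring

lemma quadratic_mul_X_add_C_mul_X_add_C {R : Type*} [CommRing R] (b d u v : R) :
    (X ^ 2 - C b * X + C (b * d)) * (X + C u) * (X + C v)
      = quartic (b * d * (u * v)) (b * (d * (u + v) - u * v)) (b * d - b * (u + v) + u * v)
        (u + v - b) 1 := by
  simp only [quartic, C_mul, C_sub, C_add, C_1]
  ring

/-- If `P * (X + D) = Q * (X + B)` for cubics `P` without quadratic term and `Q` without linear term,
then `P` is determined by `B` and `D` up to scaling. -/
lemma cofactor_of_mul_eq_mul {P Q : ℝ[X]} {B D : ℝ}
    (hP2 : P.coeff 2 = 0) (hP : ∀ k, P.coeff (k + 4) = 0)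
    (hQ1 : Q.coeff 1 = 0) (hQ2 : 0 < Q.coeff 2) (hQ3 : 0 < Q.coeff 3)
    (hQ : ∀ k, Q.coeff (k + 4) = 0)
    (h : P * (X + C D) = Q * (X + C B)) :
    B < D ∧ P = C (P.coeff 3) * ((X ^ 2 - C B * X + C (B * D)) * (X + C B)) := by
  have e0 := congrArg (fun r => r.coeff 0) h
  have e1 := congrArg (fun r => r.coeff (0 + 1)) h
  have e2 := congrArg (fun r => r.coeff (1 + 1)) h
  have e3 := congrArg (fun r => r.coeff (2 + 1)) h
  have e4 := congrArg (fun r => r.coeff (3 + 1)) h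
  simp only [coeff_succ_mul_X_add_C, coeff_zero_mul_X_add_C] at e0 e1 e2 e3 e4
  norm_num at e1 e2 e3 e4
  have hP4 := hP 0
  have hQ4 := hQ 0
  norm_num at hP4 hQ4
  rw [hP4, hQ4] at e4
  rw [hP2] at e2 e3
  rw [hQ1] at e1 e2
  simp only [zero_mul, add_zero, zero_add] at e1 e2 e3 e4
  have hBD : B < D := by
    rw [e4] at e3
    by_contra! hle
    nlinarith
  refine ⟨hBD, ?_⟩
  have c2 : Q.coeff 2 = P.coeff 3 * (D - B) := by
    rw [← e4] at e3
    linarith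
  have c1 : P.coeff 1 = P.coeff 3 * ((D - B) * B) := by
    rw [e2, c2]
    ring
  have c0 : P.coeff 0 = P.coeff 3 * (D * B ^ 2) := by
    apply mul_right_cancel₀ (sub_pos.2 hBD).ne'
    have : P.coeff 0 * (D - B) = P.coeff 1 * D * B := by
      linear_combination e0 - B * e1
    rw [this, c1]
    ring
  rw [quadratic_mul_X_add_C_left]
  ext k
  rcases k with _ | _ | _ | _ | k
  · simpa using c0
  · simpa using c1
  · simpa using hP2
  · simp
  · rw [hP, coeff_C_mul, coeff_add_four_quartic_zero, mul_zero]

theorem stmt_18 (Φ : Polynomial ℝ → Polynomial ℝ)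
    (hmap : ∀ p ∈ PQset, Φ p ∈ Pset)
    (hsupp : ∀ p ∈ PQset, ∀ k : ℕ, 0 < (Φ p).coeff k ↔ 0 < p.coeff k)
    (hmul : ∀ p ∈ PQset, ∀ q ∈ PQset, Φ (p * q) = Φ p * Φ q) :
    ∃ γ : ℝ, 0 < γ ∧ ∀ a : ℚ, 0 < a → Φ (lin (a : ℝ)) = lin (γ * (a : ℝ)) := by
  have hpos : ∀ q : ℚ[X], (∀ k, 0 ≤ q.coeff k) → 0 < q.eval 1 → ∀ k, 0 < q.coeff k →
      0 < (Φ (normalizedMap q)).coeff k := fun q hq h1 k hk =>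
    (hsupp _ (normalizedMap_mem hq h1) k).2 ((coeff_normalizedMap_pos h1 k).2 hk)
  have hzero : ∀ q : ℚ[X], (∀ k, 0 ≤ q.coeff k) → 0 < q.eval 1 → ∀ k, q.coeff k = 0 →
      (Φ (normalizedMap q)).coeff k = 0 := fun q hq h1 k hk => by
    refine le_antisymm (not_lt.1 fun h => ?_) ((hmap _ (normalizedMap_mem hq h1)).1 k)
    have := (coeff_normalizedMap_pos h1 k).1 ((hsupp _ (normalizedMap_mem hq h1) k).1 h)
    exact this.ne' hk
  have hlin_nonneg : ∀ a : ℚ, 0 < a → ∀ k, 0 ≤ (X + C a : ℚ[X]).coeff k := by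
    intro a ha k
    rcases k with _ | _ | k <;> simp [coeff_X, coeff_C, ha.le]
  have hlin_eval : ∀ a : ℚ, 0 < a → 0 < (X + C a : ℚ[X]).eval 1 := fun a ha => by
    simp only [eval_add, eval_X, eval_C]
    linarith
  have hlin_mem : ∀ a : ℚ, 0 < a → lin (a : ℝ) ∈ PQset := fun a ha => by
    rw [← normalizedMap_X_add_C]
    exact normalizedMap_mem (hlin_nonneg a ha) (hlin_eval a ha)
  have hex : ∀ a : ℚ, ∃ y : ℝ, 0 < a → 0 < y ∧ Φ (lin (a : ℝ)) = lin y := by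
    intro a
    refine ⟨(Φ (lin (a : ℝ))).coeff 0 / (Φ (lin (a : ℝ))).coeff 1, fun ha => ?_⟩
    have h0 := hpos _ (hlin_nonneg a ha) (hlin_eval a ha) 0 (by simpa using ha)
    have h1 := hpos _ (hlin_nonneg a ha) (hlin_eval a ha) 1 (by simp)
    have h2 : ∀ k, _ := fun k =>
      hzero _ (hlin_nonneg a ha) (hlin_eval a ha) (k + 2) (by simp [coeff_X])
    rw [normalizedMap_X_add_C] at h0 h1 h2
    exact ⟨div_pos h0 h1, eq_lin_of_coeff (hmap _ (hlin_mem a ha)).2 h0 h1 h2⟩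
  choose f hf using hex
  have hfpos : ∀ a, 0 < a → 0 < f a := fun a ha => (hf a ha).1
  have hΦ : ∀ a : ℚ, 0 < a → Φ (lin (a : ℝ)) = lin (f a) := fun a ha => (hf a ha).2
  have hcubic : ∀ b d : ℚ, 0 < b → b < d →
      (∀ k, 0 ≤ ((X ^ 2 - C b * X + C (b * d)) * (X + C b)).coeff k) ∧
      0 < ((X ^ 2 - C b * X + C (b * d)) * (X + C b)).eval 1 ∧ f b < f d ∧
      ∃ w : ℝ, w ≠ 0 ∧ Φ (normalizedMap ((X ^ 2 - C b * X + C (b * d)) * (X + C b)))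
        = C w * ((X ^ 2 - C (f b) * X + C (f b * f d)) * (X + C (f b))) := by
    intro b d hb hbd
    have hd := hb.trans hbd
    have hbd' := sub_pos.2 hbd
    have hp := quadratic_mul_X_add_C_left b d
    have hq := quadratic_mul_X_add_C_right b d
    set p := (X ^ 2 - C b * X + C (b * d)) * (X + C b) with hpdef
    set q := (X ^ 2 - C b * X + C (b * d)) * (X + C d) with hqdef
    have hp0 : ∀ k, 0 ≤ p.coeff k := by
      rw [hp]
      apply coeff_quartic_nonneg <;> positivity
    have hq0 : ∀ k, 0 ≤ q.coeff k := by
      rw [hq]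
      apply coeff_quartic_nonneg <;> positivity
    have hp1 : 0 < p.eval 1 := by
      rw [hp, eval_one_quartic]
      positivity
    have hq1 : 0 < q.eval 1 := by
      rw [hq, eval_one_quartic]
      positivity
    have hpq : normalizedMap p * lin d = normalizedMap q * lin b := by
      rw [← normalizedMap_X_add_C, ← normalizedMap_X_add_C, ← normalizedMap_mul,
        ← normalizedMap_mul]
      congr 1
      rw [hpdef, hqdef]
      ring
    have h := congrArg Φ hpq
    rw [hmul _ (normalizedMap_mem hp0 hp1) _ (hlin_mem d hd),
      hmul _ (normalizedMap_mem hq0 hq1) _ (hlin_mem b hb), hΦ d hd, hΦ b hb] at h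
    have hB := hfpos b hb
    have hD := hfpos d hd
    have h' : Φ (normalizedMap p) * (X + C (f d))
        = (C ((1 + f b)⁻¹ * (1 + f d)) * Φ (normalizedMap q)) * (X + C (f b)) := by
      simp only [lin] at h
      have e : (C (1 + f d)⁻¹ : ℝ[X]) * C (1 + f d) = 1 := by
        rw [← C_mul, inv_mul_cancel₀ (by positivity), C_1]
      have hne : (C (1 + f d)⁻¹ : ℝ[X]) ≠ 0 := left_ne_zero_of_mul_eq_one e
      apply mul_left_cancel₀ hne
      rw [C_mul]
      linear_combination h - (C (1 + f b)⁻¹ * Φ (normalizedMap q) * (X + C (f b))) * e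
    have hc : (0 : ℝ) < (1 + f b)⁻¹ * (1 + f d) := by positivity
    obtain ⟨hlt, hΦp⟩ := cofactor_of_mul_eq_mul
      (hzero p hp0 hp1 2 (by simp [hp]))
      (fun k => hzero p hp0 hp1 (k + 4) (by rw [hp, coeff_add_four_quartic_zero]))
      (by rw [coeff_C_mul, hzero q hq0 hq1 1 (by simp [hq]), mul_zero])
      (by
        rw [coeff_C_mul]
        exact mul_pos hc (hpos q hq0 hq1 2 (by simpa [hq] using hbd)))
      (by
        rw [coeff_C_mul]
        exact mul_pos hc (hpos q hq0 hq1 3 (by simp [hq])))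
      (fun k => by
        rw [coeff_C_mul, hzero q hq0 hq1 (k + 4) (by rw [hq, coeff_add_four_quartic_zero]),
          mul_zero])
      h'
    exact ⟨hp0, hp1, hlt, _, (hpos p hp0 hp1 3 (by simp [hp])).ne', hΦp⟩
  have hmono : ∀ b d : ℚ, 0 < b → b < d → f b < f d := fun b d hb hbd => (hcubic b d hb hbd).2.2.1
  refine ⟨f 1, hfpos 1 one_pos, fun a ha => ?_⟩
  rw [hΦ a ha, eq_mul_of_increment_relation hfpos hmono ?_ ha]
  intro b s t hb hs hs1 ht
  have hs1' := sub_pos.2 hs1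
  have hst : 0 < s * t := by positivity
  obtain ⟨d, hd⟩ : ∃ d, d = b * (1 + s * t) := ⟨_, rfl⟩
  obtain ⟨u, hu⟩ : ∃ u, u = b * (1 - s) := ⟨_, rfl⟩
  obtain ⟨v, hv⟩ : ∃ v, v = b * (1 + t) := ⟨_, rfl⟩
  rw [← hd, ← hu, ← hv]
  have hd0 : 0 < d := by rw [hd]; positivity
  have hu0 : 0 < u := by rw [hu]; positivity
  have hv0 : 0 < v := by rw [hv]; positivity
  obtain ⟨hp0, hp1, -, w, hw, hΦp⟩ := hcubic b d hb (by rw [hd]; nlinarith)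
  have hr := quadratic_mul_X_add_C_mul_X_add_C b d u v
  have c1 : 0 < b * (d * (u + v) - u * v) := by
    have : b * (d * (u + v) - u * v)
        = b ^ 3 * (1 + 2 * (s * t) + (1 - s) * (s * t) + s * t * t) := by
      rw [hd, hu, hv]
      ring
    rw [this]
    positivity
  have c2 : b * d - b * (u + v) + u * v = 0 := by
    rw [hd, hu, hv]
    ring
  have c3 : 0 < u + v - b := by
    have : u + v - b = b * (1 - s + t) := by
      rw [hu, hv]
      ring
    rw [this]
    positivity
  set p := (X ^ 2 - C b * X + C (b * d)) * (X + C b) with hpdef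
  set r := (X ^ 2 - C b * X + C (b * d)) * (X + C u) * (X + C v) with hrdef
  have hr0 : ∀ k, 0 ≤ r.coeff k := by
    rw [hr]
    exact coeff_quartic_nonneg (by positivity) c1.le c2.ge c3.le one_pos.le
  have hr1 : 0 < r.eval 1 := by
    rw [hr, eval_one_quartic, c2]
    positivity
  have hprod : normalizedMap p * lin u * lin v = normalizedMap r * lin b := by
    rw [← normalizedMap_X_add_C, ← normalizedMap_X_add_C, ← normalizedMap_X_add_C,
      ← normalizedMap_mul, ← normalizedMap_mul, ← normalizedMap_mul]
    congr 1
    rw [hpdef, hrdef]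
    ring
  have hpu : normalizedMap p * lin u ∈ PQset := by
    rw [← normalizedMap_X_add_C, ← normalizedMap_mul]
    refine normalizedMap_mem (coeff_mul_nonneg hp0 (hlin_nonneg u hu0)) ?_
    rw [eval_mul]
    exact mul_pos hp1 (hlin_eval u hu0)
  have h := congrArg Φ hprod
  rw [hmul _ hpu _ (hlin_mem v hv0), hmul _ (normalizedMap_mem hp0 hp1) _ (hlin_mem u hu0),
    hmul _ (normalizedMap_mem hr0 hr1) _ (hlin_mem b hb), hΦ b hb, hΦ u hu0, hΦ v hv0, hΦp] at h
  have hB := hfpos b hb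
  have hU := hfpos u hu0
  have hV := hfpos v hv0
  have hcancel : C (w * (1 + f u)⁻¹ * (1 + f v)⁻¹)
      * ((X ^ 2 - C (f b) * X + C (f b * f d)) * (X + C (f u)) * (X + C (f v)))
      = Φ (normalizedMap r) * C (1 + f b)⁻¹ := by
    apply mul_right_cancel₀ (X_add_C_ne_zero (f b))
    simp only [lin] at h
    rw [C_mul, C_mul]
    linear_combination h
  have h2 := congrArg (fun q => q.coeff 2) hcancel
  simp only [quadratic_mul_X_add_C_mul_X_add_C, coeff_C_mul, coeff_mul_C, coeff_two_quartic] at h2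
  rw [hzero r hr0 hr1 2 (by rw [hr, coeff_two_quartic, c2]), zero_mul] at h2
  have h3 := (mul_eq_zero.1 h2).resolve_left (by positivity)
  linear_combination h3
end

section
/- Let Ψ : ℳ_ℚ → ℳ be multiplicative and degree-preserving, with Ψ[p] ∈ 𝒫 for every p ∈ 𝒫_ℚ, and suppose the restriction of Ψ to 𝒫_ℚ is support-preserving and that Ψ[(X+1)/2] = (X+1)/2. Then for every rational a ∈ (−2,2) and every rational γ > 0, Ψ[(X²−aγX+γ²)/(1−aγ+γ²)] = (X²−aγX+γ²)/(1−aγ+γ²). -/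
open Polynomial

/-- `Mset` is the set of real polynomials `p` with `p(1) = 1` that are positive on the
positive reals. -/
def Mset : Set (Polynomial ℝ) := {p | p.eval 1 = 1 ∧ ∀ x : ℝ, 0 < x → 0 < p.eval x}

/-- `MQset` is the subset of `Mset` of polynomials with rational coefficients. -/
def MQset : Set (Polynomial ℝ) := {p | p ∈ Mset ∧ ∀ k : ℕ, ∃ r : ℚ, p.coeff k = (r : ℝ)}

/-- Monic rational polynomials with nonnegative coefficients. -/
def MonicNonneg (p : ℚ[X]) : Prop := p.Monic ∧ ∀ k, 0 ≤ p.coeff k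

/-- Monic rational polynomials having a multiple with nonnegative coefficients, the cofactor
being itself monic with nonnegative coefficients. -/
def MonicNonnegFactor (q : ℚ[X]) : Prop :=
  q.Monic ∧ ∃ g, MonicNonneg g ∧ MonicNonneg (g * q)

/-- A multiplicative, monic and degree-preserving map which does not enlarge the support of
polynomials with nonnegative coefficients and which fixes `X + 1`. -/
structure SupportMap (Φ : ℚ[X] → ℝ[X]) : Prop where
  mul : ∀ q, MonicNonnegFactor q → ∀ r, MonicNonnegFactor r → Φ (q * r) = Φ q * Φ r
  monic : ∀ q, MonicNonnegFactor q → (Φ q).Monic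
  natDegree : ∀ q, MonicNonnegFactor q → (Φ q).natDegree = q.natDegree
  coeff_eq_zero : ∀ p, MonicNonneg p → ∀ k, p.coeff k = 0 → (Φ p).coeff k = 0
  X_add_one : Φ (X + C 1) = X + C 1

/-- The monic quadratic polynomial `X ^ 2 + s X + c`. -/
noncomputable def quad {R : Type*} [CommRing R] (s c : R) : R[X] := X ^ 2 + C s * X + C c

theorem quad_monic {R : Type*} [CommRing R] (s c : R) : (quad s c).Monic := by
  unfold quad
  monicity!

theorem eq_quad {p : ℝ[X]} (hp : p.Monic) (hd : p.natDegree = 2) :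
    p = quad (p.coeff 1) (p.coeff 0) := by
  have h2 : p.coeff 2 = 1 := by rw [← hd]; exact hp
  conv_lhs => rw [p.as_sum_range_C_mul_X_pow, hd]
  simp only [Finset.sum_range_succ, Finset.sum_range_zero, h2, quad]
  simp
  ring

theorem eq_X_add_C {p : ℝ[X]} (hp : p.Monic) (hd : p.natDegree = 1) :
    p = X + C (p.coeff 0) := by
  have h1 : p.coeff 1 = 1 := by rw [← hd]; exact hp
  conv_lhs => rw [p.as_sum_range_C_mul_X_pow, hd]
  simp only [Finset.sum_range_succ, Finset.sum_range_zero, h1]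
  simp
  ring

section Products

variable {R : Type*} [CommRing R]

theorem X_add_C_mul_quad (a s c : R) :
    (X + C a) * quad s c = X ^ 3 + C (a + s) * X ^ 2 + C (c + a * s) * X + C (a * c) := by
  simp only [quad, C_add, C_mul]
  ring

theorem X_add_C_mul_X_add_C (a b : R) : (X + C a) * (X + C b) = quad (a + b) (a * b) := by
  simp only [quad, C_add, C_mul]
  ring

theorem quad_mul_quad (s c t d : R) :
    quad s c * quad t d = X ^ 4 + C (s + t) * X ^ 3 + C (c + d + s * t) * X ^ 2
      + C (s * d + t * c) * X + C (c * d) := by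
  simp only [quad, C_add, C_mul]
  ring

theorem quad_mul_quad_neg (s c : R) :
    quad s c * quad (-s) c = expand R 2 (quad (2 * c - s ^ 2) (c ^ 2)) := by
  simp only [quad, map_add, map_mul, map_pow, map_sub, map_neg, map_ofNat, expand_C,
    expand_X]
  ring

theorem X_add_C_mul_quad_coeff_two (a s c : R) : ((X + C a) * quad s c).coeff 2 = a + s := by
  rw [X_add_C_mul_quad]
  simp only [coeff_add, coeff_C_mul, coeff_X_pow, coeff_X, coeff_C]
  norm_num

theorem X_add_C_mul_quad_coeff_one (a s c : R) :
    ((X + C a) * quad s c).coeff 1 = c + a * s := by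
  rw [X_add_C_mul_quad]
  simp only [coeff_add, coeff_C_mul, coeff_X_pow, coeff_X, coeff_C]
  norm_num

theorem quad_mul_quad_coeff_three (s c t d : R) : (quad s c * quad t d).coeff 3 = s + t := by
  rw [quad_mul_quad]
  simp only [coeff_add, coeff_C_mul, coeff_X_pow, coeff_X, coeff_C]
  norm_num

theorem quad_mul_quad_coeff_one (s c t d : R) :
    (quad s c * quad t d).coeff 1 = s * d + t * c := by
  rw [quad_mul_quad]
  simp only [coeff_add, coeff_C_mul, coeff_X_pow, coeff_X, coeff_C]
  norm_num

theorem quad_zero_mul_quad_mul_quad_coeff_four (e s c t d : R) :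
    (quad 0 e * (quad s c * quad t d)).coeff 4 = e + (c + d + s * t) := by
  have h : quad 0 e * (quad s c * quad t d) = X ^ 6 + C (s + t) * X ^ 5
      + C (e + (c + d + s * t)) * X ^ 4 + C (e * (s + t) + (s * d + t * c)) * X ^ 3
      + C (e * (c + d + s * t) + c * d) * X ^ 2 + C (e * (s * d + t * c)) * X
      + C (e * (c * d)) := by
    rw [quad_mul_quad]
    simp only [quad, C_add, C_mul, C_0]
    ring
  rw [h]
  simp only [coeff_add, coeff_C_mul, coeff_X_pow, coeff_X, coeff_C]
  norm_num

end Products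

theorem coeff_nonneg_add {p q : ℚ[X]} (hp : ∀ k, 0 ≤ p.coeff k) (hq : ∀ k, 0 ≤ q.coeff k) :
    ∀ k, 0 ≤ (p + q).coeff k := fun k => by
  rw [coeff_add]
  exact add_nonneg (hp k) (hq k)

theorem coeff_nonneg_X_pow (n : ℕ) : ∀ k, 0 ≤ (X ^ n : ℚ[X]).coeff k := fun k => by
  rw [coeff_X_pow]
  split_ifs <;> simp

theorem coeff_nonneg_C_mul_X_pow {a : ℚ} (ha : 0 ≤ a) (n : ℕ) :
    ∀ k, 0 ≤ (C a * X ^ n : ℚ[X]).coeff k := fun k => by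
  rw [coeff_C_mul]
  exact mul_nonneg ha (coeff_nonneg_X_pow n k)

theorem coeff_nonneg_C_mul_X {a : ℚ} (ha : 0 ≤ a) :
    ∀ k, 0 ≤ (C a * X : ℚ[X]).coeff k := by
  simpa using coeff_nonneg_C_mul_X_pow ha 1

theorem coeff_nonneg_C {a : ℚ} (ha : 0 ≤ a) : ∀ k, 0 ≤ (C a : ℚ[X]).coeff k := by
  simpa using coeff_nonneg_C_mul_X_pow ha 0

namespace MonicNonneg

theorem mul {p q : ℚ[X]} (hp : MonicNonneg p) (hq : MonicNonneg q) :
    MonicNonneg (p * q) :=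
  ⟨hp.1.mul hq.1, fun k => by
    rw [coeff_mul]
    exact Finset.sum_nonneg fun i _ => mul_nonneg (hp.2 _) (hq.2 _)⟩

theorem expand_two {p : ℚ[X]} (hp : MonicNonneg p) : MonicNonneg (expand ℚ 2 p) :=
  ⟨hp.1.expand two_pos, fun k => by
    rw [coeff_expand two_pos]
    split_ifs
    exacts [hp.2 _, le_rfl]⟩

theorem X_add_C_mem {a : ℚ} (ha : 0 ≤ a) : MonicNonneg (X + C a) :=
  ⟨monic_X_add_C a,
    coeff_nonneg_add (by simpa using coeff_nonneg_X_pow 1) (coeff_nonneg_C ha)⟩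

theorem quad_mem {s c : ℚ} (hs : 0 ≤ s) (hc : 0 ≤ c) : MonicNonneg (quad s c) :=
  ⟨quad_monic s c, coeff_nonneg_add
    (coeff_nonneg_add (coeff_nonneg_X_pow 2) (coeff_nonneg_C_mul_X hs)) (coeff_nonneg_C hc)⟩

theorem X_add_C_mul_quad_mem {a s c : ℚ} (h2 : 0 ≤ a + s) (h1 : 0 ≤ c + a * s)
    (h0 : 0 ≤ a * c) : MonicNonneg ((X + C a) * quad s c) := by
  refine ⟨(monic_X_add_C a).mul (quad_monic s c), ?_⟩
  rw [X_add_C_mul_quad]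
  exact coeff_nonneg_add (coeff_nonneg_add (coeff_nonneg_add (coeff_nonneg_X_pow 3)
    (coeff_nonneg_C_mul_X_pow h2 2)) (coeff_nonneg_C_mul_X h1)) (coeff_nonneg_C h0)

theorem quad_mul_quad_mem {s c t d : ℚ} (h3 : 0 ≤ s + t) (h2 : 0 ≤ c + d + s * t)
    (h1 : 0 ≤ s * d + t * c) (h0 : 0 ≤ c * d) : MonicNonneg (quad s c * quad t d) := by
  refine ⟨(quad_monic s c).mul (quad_monic t d), ?_⟩
  rw [quad_mul_quad]
  exact coeff_nonneg_add (coeff_nonneg_add (coeff_nonneg_add (coeff_nonneg_add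
    (coeff_nonneg_X_pow 4) (coeff_nonneg_C_mul_X_pow h3 3)) (coeff_nonneg_C_mul_X_pow h2 2))
    (coeff_nonneg_C_mul_X h1)) (coeff_nonneg_C h0)

theorem mem_factor {p : ℚ[X]} (hp : MonicNonneg p) : MonicNonnegFactor p :=
  ⟨hp.1, p, hp, hp.mul hp⟩

theorem eval_pos {p : ℚ[X]} (hp : MonicNonneg p) {x : ℝ} (hx : 0 < x) :
    0 < aeval x p := by
  rw [aeval_eq_sum_range]
  refine Finset.sum_pos' (fun i _ => ?_) ⟨p.natDegree, by simp, ?_⟩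
  · rw [Algebra.smul_def]
    exact mul_nonneg (by simpa using hp.2 i) (by positivity)
  · rw [show p.coeff p.natDegree = 1 from hp.1, one_smul]
    positivity

end MonicNonneg

namespace MonicNonnegFactor

theorem mul {p q : ℚ[X]} (hp : MonicNonnegFactor p) (hq : MonicNonnegFactor q) :
    MonicNonnegFactor (p * q) := by
  obtain ⟨hpm, g, hg, hgp⟩ := hp
  obtain ⟨hqm, h, hh, hhq⟩ := hq
  refine ⟨hpm.mul hqm, g * h, MonicNonneg.mul hg hh, ?_⟩
  rw [mul_mul_mul_comm]
  exact MonicNonneg.mul hgp hhq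

theorem expand_two {p : ℚ[X]} (hp : MonicNonnegFactor p) :
    MonicNonnegFactor (expand ℚ 2 p) := by
  obtain ⟨hpm, g, hg, hgp⟩ := hp
  refine ⟨hpm.expand two_pos, expand ℚ 2 g, MonicNonneg.expand_two hg, ?_⟩
  rw [← map_mul]
  exact MonicNonneg.expand_two hgp

theorem eval_pos {p : ℚ[X]} (hp : MonicNonnegFactor p) {x : ℝ} (hx : 0 < x) :
    0 < aeval x p := by
  obtain ⟨-, g, hg, hgp⟩ := hp
  have h := MonicNonneg.eval_pos hgp hx
  rw [map_mul] at h
  exact pos_of_mul_pos_right h (MonicNonneg.eval_pos hg hx).le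

theorem quad_neg_mem_of_sq_le {s c : ℚ} (hs : 0 < s) (hc : s ^ 2 ≤ c) :
    MonicNonnegFactor (quad (-s) c) :=
  ⟨quad_monic _ _, X + C s, MonicNonneg.X_add_C_mem hs.le,
    MonicNonneg.X_add_C_mul_quad_mem (by linarith) (by nlinarith)
      (mul_nonneg hs.le ((sq_nonneg s).trans hc))⟩

theorem quad_neg_mem_of_expand {s c : ℚ} (hs : 0 ≤ s) (hc : 0 ≤ c)
    (h : MonicNonnegFactor (quad (2 * c - s ^ 2) (c ^ 2))) :
    MonicNonnegFactor (quad (-s) c) := by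
  obtain ⟨-, g, hg, hgq⟩ := h
  refine ⟨quad_monic _ _, expand ℚ 2 g * quad s c,
    MonicNonneg.mul (MonicNonneg.expand_two hg) (MonicNonneg.quad_mem hs hc), ?_⟩
  rw [mul_assoc, quad_mul_quad_neg, ← map_mul]
  exact MonicNonneg.expand_two hgq

end MonicNonnegFactor

theorem expand_contract_two_of_odd {p : ℝ[X]} (hp : ∀ k, ¬ 2 ∣ k → p.coeff k = 0) :
    expand ℝ 2 (contract 2 p) = p := by
  ext k
  rw [coeff_expand two_pos]
  split_ifs with h
  · rw [coeff_contract two_ne_zero, Nat.div_mul_cancel h]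
  · exact (hp k h).symm

theorem comp_neg_X_coeff (p : ℝ[X]) (k : ℕ) : (p.comp (-X)).coeff k = (-1) ^ k * p.coeff k := by
  have h : (-X : ℝ[X]) = C (-1) * X := by simp
  rw [h, comp_C_mul_X_coeff, mul_comm]

theorem comp_neg_X_eq_of_odd {p : ℝ[X]} (hp : ∀ k, ¬ 2 ∣ k → p.coeff k = 0) :
    p.comp (-X) = p := by
  ext k
  rw [comp_neg_X_coeff]
  by_cases h : 2 ∣ k
  · rw [(even_iff_two_dvd.2 h).neg_one_pow, one_mul]
  · rw [hp k h, mul_zero]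

theorem odd_coeff_eq_zero_of_mul {p q : ℝ[X]} (h0 : p ≠ 0)
    (hp : ∀ k, ¬ 2 ∣ k → p.coeff k = 0) (hpq : ∀ k, ¬ 2 ∣ k → (p * q).coeff k = 0) (k : ℕ)
    (hk : ¬ 2 ∣ k) : q.coeff k = 0 := by
  have h := comp_neg_X_eq_of_odd hpq
  rw [mul_comp, comp_neg_X_eq_of_odd hp] at h
  have h' := congrArg (fun r => r.coeff k) (mul_left_cancel₀ h0 h)
  simp only [comp_neg_X_coeff] at h'
  rw [(Nat.not_even_iff_odd.1 (mt even_iff_two_dvd.1 hk)).neg_one_pow] at h'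
  linarith

namespace SupportMap

variable {Φ : ℚ[X] → ℝ[X]}

theorem exists_quad (hΦ : SupportMap Φ) {s c : ℚ} (h : MonicNonnegFactor (quad s c)) :
    ∃ s' c' : ℝ, Φ (quad s c) = quad s' c' := by
  refine ⟨_, _, eq_quad (hΦ.monic _ h) ?_⟩
  rw [hΦ.natDegree _ h]
  unfold quad
  compute_degree!

theorem exists_X_add_C (hΦ : SupportMap Φ) {a : ℚ} (ha : 0 ≤ a) :
    ∃ b : ℝ, Φ (X + C a) = X + C b := by
  have h := (MonicNonneg.X_add_C_mem ha).mem_factor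
  refine ⟨_, eq_X_add_C (hΦ.monic _ h) ?_⟩
  rw [hΦ.natDegree _ h, natDegree_X_add_C]

theorem mul_coeff_eq_zero (hΦ : SupportMap Φ) {p q : ℚ[X]} (hp : MonicNonnegFactor p)
    (hq : MonicNonnegFactor q) (hpq : MonicNonneg (p * q)) {k : ℕ}
    (hk : (p * q).coeff k = 0) : (Φ p * Φ q).coeff k = 0 := by
  rw [← hΦ.mul p hp q hq]
  exact hΦ.coeff_eq_zero _ hpq k hk

theorem exists_quad_neg (hΦ : SupportMap Φ) {s c : ℚ} (hs : 0 < s) (hc : s ^ 2 ≤ c) {b : ℝ}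
    (hb : Φ (X + C s) = X + C b) : ∃ c' : ℝ, Φ (quad (-s) c) = quad (-b) c' := by
  have hq := MonicNonnegFactor.quad_neg_mem_of_sq_le hs hc
  obtain ⟨s', c', h⟩ := hΦ.exists_quad hq
  have h0 := hΦ.mul_coeff_eq_zero (k := 2) (MonicNonneg.X_add_C_mem hs.le).mem_factor hq
    (MonicNonneg.X_add_C_mul_quad_mem (by linarith) (by nlinarith)
      (mul_nonneg hs.le ((sq_nonneg s).trans hc)))
    (by rw [X_add_C_mul_quad_coeff_two]; ring)
  rw [hb, h, X_add_C_mul_quad_coeff_two] at h0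
  exact ⟨c', by rw [h, eq_neg_of_add_eq_zero_right h0]⟩

theorem X_add_C_add (hΦ : SupportMap Φ) {a b : ℚ} (ha : 0 < a) (hb : 0 < b) {a' b' : ℝ}
    (ha' : Φ (X + C a) = X + C a') (hb' : Φ (X + C b) = X + C b') :
    Φ (X + C (a + b)) = X + C (a' + b') := by
  obtain ⟨e, he⟩ := hΦ.exists_X_add_C (add_pos ha hb).le
  obtain ⟨c', hc'⟩ := hΦ.exists_quad_neg (add_pos ha hb) le_rfl he
  have hlin {a : ℚ} (ha : 0 < a) := (MonicNonneg.X_add_C_mem ha.le).mem_factor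
  have hab : Φ (quad (a + b) (a * b)) = quad (a' + b') (a' * b') := by
    rw [← X_add_C_mul_X_add_C, hΦ.mul _ (hlin ha) _ (hlin hb), ha', hb', X_add_C_mul_X_add_C]
  have h0 := hΦ.mul_coeff_eq_zero (k := 3)
    (MonicNonneg.quad_mem (add_pos ha hb).le (mul_pos ha hb).le).mem_factor
    (MonicNonnegFactor.quad_neg_mem_of_sq_le (add_pos ha hb) le_rfl)
    (MonicNonneg.quad_mul_quad_mem (by linarith) (by nlinarith [mul_pos ha hb])
      (by nlinarith [mul_pos (add_pos ha hb) (mul_pos ha hb),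
        mul_nonneg (add_pos ha hb).le (add_nonneg (add_nonneg (sq_nonneg a) (sq_nonneg b))
          (mul_pos ha hb).le)]) (by positivity))
    (by rw [quad_mul_quad_coeff_three]; ring)
  rw [hab, hc', quad_mul_quad_coeff_three] at h0
  rw [he, show e = a' + b' by linarith]

theorem X_add_C_nat_mul (hΦ : SupportMap Φ) {a : ℚ} (ha : 0 < a) {a' : ℝ}
    (ha' : Φ (X + C a) = X + C a') (n : ℕ) :
    Φ (X + C ((n + 1 : ℚ) * a)) = X + C ((n + 1 : ℝ) * a') := by
  induction n with
  | zero => simpa using ha'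
  | succ n ih =>
    have h := hΦ.X_add_C_add (by positivity) ha ih ha'
    convert h using 3 <;> push_cast <;> ring_nf

theorem X_add_C (hΦ : SupportMap Φ) {a : ℚ} (ha : 0 < a) :
    Φ (X + C a) = X + C (a : ℝ) := by
  obtain ⟨b, hb⟩ := hΦ.exists_X_add_C ha.le
  obtain ⟨m, hm⟩ : ∃ m : ℕ, a.num = m + 1 :=
    ⟨(a.num - 1).toNat, by have := Rat.num_pos.2 ha; omega⟩
  obtain ⟨n, hn⟩ : ∃ n : ℕ, a.den = n + 1 := Nat.exists_eq_succ_of_ne_zero a.den_nz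
  have han : ((n : ℚ) + 1) * a = (m + 1) * 1 := by
    have h := a.den_mul_eq_num
    rw [hm, hn] at h
    push_cast at h
    linarith
  have h1 := hΦ.X_add_C_nat_mul ha hb n
  have h2 := hΦ.X_add_C_nat_mul one_pos hΦ.X_add_one m
  rw [han, h2] at h1
  have h3 : ((m : ℝ) + 1) * 1 = (n + 1) * b := C_injective (add_left_cancel h1)
  have h4 : ((n : ℝ) + 1) * a = (m + 1) * 1 := by exact_mod_cast han
  have h5 : (a : ℝ) = b := mul_left_cancel₀ (by positivity : (n : ℝ) + 1 ≠ 0) (h4.trans h3)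
  rw [hb, h5]

theorem quad_neg_of_sq_le (hΦ : SupportMap Φ) {s c : ℚ} (hs : 0 < s) (hc : s ^ 2 ≤ c) :
    Φ (quad (-s) c) = quad (-s : ℝ) (c : ℝ) := by
  obtain ⟨c', h⟩ := hΦ.exists_quad_neg hs hc (hΦ.X_add_C hs)
  have hc0 : 0 < c := (by positivity : 0 < s ^ 2).trans_le hc
  have hb : 0 < c / s := div_pos hc0 hs
  have hsb : s ≤ c / s := (le_div_iff₀ hs).2 (by linarith)
  have hbs : c / s * s = c := div_mul_cancel₀ c hs.ne'
  have h0 := hΦ.mul_coeff_eq_zero (k := 1) (MonicNonneg.X_add_C_mem hb.le).mem_factor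
    (MonicNonnegFactor.quad_neg_mem_of_sq_le hs hc)
    (MonicNonneg.X_add_C_mul_quad_mem (by linarith) (by linarith) (by positivity))
    (by rw [X_add_C_mul_quad_coeff_one]; linarith)
  rw [hΦ.X_add_C hb, h, X_add_C_mul_quad_coeff_one] at h0
  have hbs' : ((c / s : ℚ) : ℝ) * s = c := by exact_mod_cast hbs
  rw [h, show c' = c by linarith]

theorem quad_pos (hΦ : SupportMap Φ) {s c : ℚ} (hs : 0 < s) (hc : 0 < c) :
    Φ (quad s c) = quad (s : ℝ) (c : ℝ) := by
  have hq := (MonicNonneg.quad_mem hs.le hc.le).mem_factor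
  obtain ⟨s', c', h⟩ := hΦ.exists_quad hq
  have hs2 : s ^ 2 ≤ s ^ 2 + c := by linarith
  have h3 := hΦ.mul_coeff_eq_zero (k := 3) hq
    (MonicNonnegFactor.quad_neg_mem_of_sq_le hs hs2)
    (MonicNonneg.quad_mul_quad_mem (by linarith) (by nlinarith)
      (by have : 0 ≤ s ^ 3 := by positivity
          linarith) (by positivity))
    (by rw [quad_mul_quad_coeff_three]; ring)
  rw [h, hΦ.quad_neg_of_sq_le hs hs2, quad_mul_quad_coeff_three] at h3
  obtain ⟨t, ht, hts, htc⟩ : ∃ t : ℚ, 0 < t ∧ t ≤ s ∧ t * s ≤ c :=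
    ⟨min s (c / s), lt_min hs (div_pos hc hs), min_le_left _ _,
      (le_div_iff₀ hs).1 (min_le_right _ _)⟩
  have hd : 0 < t * c / s := by positivity
  have hds : s * (t * c / s) = t * c := mul_div_cancel₀ _ hs.ne'
  have htd : t ^ 2 ≤ t * c / s := (le_div_iff₀ hs).2 (by nlinarith)
  have h1 := hΦ.mul_coeff_eq_zero (k := 1) hq
    (MonicNonnegFactor.quad_neg_mem_of_sq_le ht htd)
    (MonicNonneg.quad_mul_quad_mem (by linarith) (by nlinarith) (by linarith)
      (by positivity))
    (by rw [quad_mul_quad_coeff_one]; linarith)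
  rw [h, hΦ.quad_neg_of_sq_le ht htd, quad_mul_quad_coeff_one,
    show s' = s by linarith] at h1
  have hds' : (s : ℝ) * ((t * c / s : ℚ) : ℝ) = t * c := by exact_mod_cast hds
  have ht' : (t : ℝ) ≠ 0 := by exact_mod_cast ht.ne'
  have hcc : c' = c := mul_left_cancel₀ ht' (by linarith)
  rw [h, hcc, show s' = s by linarith]

theorem quad_zero (hΦ : SupportMap Φ) {c : ℚ} (hc : 0 < c) :
    Φ (quad 0 c) = quad 0 (c : ℝ) := by
  have hq := MonicNonneg.quad_mem le_rfl hc.le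
  obtain ⟨s', c', h⟩ := hΦ.exists_quad hq.mem_factor
  have hs' : s' = 0 := by
    have h1 := hΦ.coeff_eq_zero _ hq 1 (by simp [quad, coeff_X_pow])
    rw [h] at h1
    simpa [quad, coeff_X_pow] using h1
  have hs : 0 < 1 + c + c ^ 2 := by positivity
  have hr := MonicNonnegFactor.mul
    (MonicNonnegFactor.quad_neg_mem_of_sq_le (s := 1) (c := 1) one_pos (by norm_num))
    (MonicNonneg.quad_mem hs.le (sq_nonneg c)).mem_factor
  have hprod : quad 0 c * (quad (-1) 1 * quad (1 + c + c ^ 2) (c ^ 2)) = X ^ 6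
      + C (c + c ^ 2) * X ^ 5 + C (1 + c + c ^ 2 + c ^ 3) * X ^ 3 + C (c + c ^ 2) * X
      + C (c ^ 3) := by
    simp only [quad, C_add, C_pow, C_neg, C_1, C_0]
    ring
  have h4 := hΦ.mul_coeff_eq_zero (k := 4) hq.mem_factor hr
    ⟨(quad_monic _ _).mul hr.1, by
      rw [hprod]
      exact coeff_nonneg_add (coeff_nonneg_add (coeff_nonneg_add (coeff_nonneg_add
        (coeff_nonneg_X_pow 6) (coeff_nonneg_C_mul_X_pow (by positivity) 5))
        (coeff_nonneg_C_mul_X_pow (by positivity) 3)) (coeff_nonneg_C_mul_X (by positivity)))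
        (coeff_nonneg_C (by positivity))⟩
    (by rw [quad_zero_mul_quad_mul_quad_coeff_four]; ring)
  rw [hΦ.mul _ (MonicNonnegFactor.quad_neg_mem_of_sq_le one_pos (by norm_num)) _
    (MonicNonneg.quad_mem hs.le (sq_nonneg c)).mem_factor,
    hΦ.quad_neg_of_sq_le one_pos (by norm_num), hΦ.quad_pos hs (by positivity), h, hs',
    quad_zero_mul_quad_mul_quad_coeff_four] at h4
  push_cast at h4
  rw [h, hs', show c' = c by linarith]

theorem quad_nonneg (hΦ : SupportMap Φ) {s c : ℚ} (hs : 0 ≤ s) (hc : 0 < c) :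
    Φ (quad s c) = quad (s : ℝ) (c : ℝ) := by
  rcases hs.eq_or_lt with rfl | hs
  · simpa using hΦ.quad_zero hc
  · exact hΦ.quad_pos hs hc

/-- `Φ (q (X ^ 2))` is again a polynomial in `X ^ 2`. -/
theorem expand_contract (hΦ : SupportMap Φ) {q : ℚ[X]} (hq : MonicNonnegFactor q) :
    expand ℝ 2 (contract 2 (Φ (expand ℚ 2 q))) = Φ (expand ℚ 2 q) := by
  have hodd : ∀ p, MonicNonneg p → ∀ k, ¬ 2 ∣ k → (Φ (expand ℚ 2 p)).coeff k = 0 :=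
    fun p hp k hk => hΦ.coeff_eq_zero _ (MonicNonneg.expand_two hp) k (by
      rw [coeff_expand two_pos, if_neg hk])
  have hq' := hq
  obtain ⟨-, g, hg, hgq⟩ := hq'
  have hge := MonicNonnegFactor.expand_two hg.mem_factor
  refine expand_contract_two_of_odd
    (odd_coeff_eq_zero_of_mul (hΦ.monic _ hge).ne_zero (hodd g hg) ?_)
  rw [← hΦ.mul _ hge _ (MonicNonnegFactor.expand_two hq), ← map_mul]
  exact hodd _ hgq

theorem contract_expand (hΦ : SupportMap Φ) :
    SupportMap fun q => contract 2 (Φ (expand ℚ 2 q)) where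
  mul q hq r hr := expand_injective two_pos (by
    rw [hΦ.expand_contract (MonicNonnegFactor.mul hq hr), map_mul, map_mul,
      hΦ.expand_contract hq, hΦ.expand_contract hr,
      hΦ.mul _ (MonicNonnegFactor.expand_two hq) _ (MonicNonnegFactor.expand_two hr)])
  monic q hq := by
    rw [← monic_expand_iff two_pos, hΦ.expand_contract hq]
    exact hΦ.monic _ (MonicNonnegFactor.expand_two hq)
  natDegree q hq := by
    have h := hΦ.natDegree _ (MonicNonnegFactor.expand_two hq)
    rw [← hΦ.expand_contract hq, natDegree_expand, natDegree_expand] at h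
    exact Nat.eq_of_mul_eq_mul_right two_pos h
  coeff_eq_zero p hp k hk := by
    rw [coeff_contract two_ne_zero]
    exact hΦ.coeff_eq_zero _ (MonicNonneg.expand_two hp) _ (by rwa [coeff_expand_mul two_pos])
  X_add_one := expand_injective two_pos (by
    rw [hΦ.expand_contract (MonicNonneg.X_add_C_mem zero_le_one).mem_factor]
    have h := hΦ.quad_zero one_pos
    simpa [quad] using h)

theorem quad_neg_of_expand (hΦ : SupportMap Φ) {s c : ℚ} (hs : 0 < s) (hc : 0 < c)
    (hq : MonicNonnegFactor (quad (2 * c - s ^ 2) (c ^ 2)))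
    (h : contract 2 (Φ (expand ℚ 2 (quad (2 * c - s ^ 2) (c ^ 2)))) =
      quad (2 * c - s ^ 2 : ℝ) (c ^ 2 : ℝ)) :
    Φ (quad (-s) c) = quad (-s : ℝ) (c : ℝ) := by
  apply mul_left_cancel₀ (quad_monic (s : ℝ) (c : ℝ)).ne_zero
  rw [quad_mul_quad_neg, ← h, hΦ.expand_contract hq, ← quad_mul_quad_neg,
    hΦ.mul _ (MonicNonneg.quad_mem hs.le hc.le).mem_factor _
      (MonicNonnegFactor.quad_neg_mem_of_expand hs.le hc.le hq), hΦ.quad_pos hs hc]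

end SupportMap

/-- Each step doubles the argument of the complex roots, by passing from `q (X)` to
`q (X) q (-X)`. -/
theorem quad_mem_and_fixed_of_discrim_le (n : ℕ) (s c : ℚ) (hc : 0 < c)
    (h : 3 * c ≤ 2 ^ n * (4 * c - s ^ 2)) :
    MonicNonnegFactor (quad s c) ∧
      ∀ Φ, SupportMap Φ → Φ (quad s c) = quad (s : ℝ) (c : ℝ) := by
  rcases le_or_gt 0 s with hs | hneg
  · exact ⟨(MonicNonneg.quad_mem hs hc.le).mem_factor, fun Φ hΦ => hΦ.quad_nonneg hs hc⟩
  obtain ⟨s, rfl⟩ : ∃ t, s = -t := ⟨-s, (neg_neg s).symm⟩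
  have hs : 0 < s := neg_neg_iff_pos.1 hneg
  clear hneg
  rw [neg_sq] at h
  push_cast
  induction n generalizing s c with
  | zero =>
    have hsc : s ^ 2 ≤ c := by linarith
    exact ⟨MonicNonnegFactor.quad_neg_mem_of_sq_le hs hsc,
      fun Φ hΦ => hΦ.quad_neg_of_sq_le hs hsc⟩
  | succ n ih =>
    have key : MonicNonnegFactor (quad (2 * c - s ^ 2) (c ^ 2)) ∧ ∀ Φ, SupportMap Φ →
        Φ (quad (2 * c - s ^ 2) (c ^ 2)) = quad (2 * c - s ^ 2 : ℝ) (c ^ 2 : ℝ) := by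
      rcases le_or_gt 0 (2 * c - s ^ 2) with hsc | hsc
      · refine ⟨(MonicNonneg.quad_mem hsc (sq_nonneg c)).mem_factor, fun Φ hΦ => ?_⟩
        simpa using hΦ.quad_nonneg hsc (by positivity : 0 < c ^ 2)
      · have hd : 0 ≤ 2 ^ n * (4 * c - s ^ 2) := by
          rw [pow_succ] at h
          linarith
        have := ih (c ^ 2) (by positivity) (s ^ 2 - 2 * c) (by
          calc 3 * c ^ 2 = c * (3 * c) := by ring
            _ ≤ c * (2 ^ (n + 1) * (4 * c - s ^ 2)) := by gcongr
            _ = (2 * c) * (2 ^ n * (4 * c - s ^ 2)) := by ring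
            _ ≤ s ^ 2 * (2 ^ n * (4 * c - s ^ 2)) := by gcongr; linarith
            _ = 2 ^ n * (4 * c ^ 2 - (s ^ 2 - 2 * c) ^ 2) := by ring) (by linarith)
        push_cast at this
        simpa only [neg_sub] using this
    exact ⟨MonicNonnegFactor.quad_neg_mem_of_expand hs.le hc.le key.1, fun Φ hΦ =>
      hΦ.quad_neg_of_expand hs hc key.1 (key.2 _ hΦ.contract_expand)⟩

theorem quad_mem_and_fixed {s c : ℚ} (h : s ^ 2 < 4 * c) :
    MonicNonnegFactor (quad s c) ∧
      ∀ Φ, SupportMap Φ → Φ (quad s c) = quad (s : ℝ) (c : ℝ) := by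
  have hd : 0 < 4 * c - s ^ 2 := by linarith
  obtain ⟨n, hn⟩ := pow_unbounded_of_one_lt (3 * c / (4 * c - s ^ 2)) one_lt_two
  exact quad_mem_and_fixed_of_discrim_le n s c (by nlinarith [sq_nonneg s])
    ((div_le_iff₀ hd).1 hn.le)

/-- The real polynomial obtained by scaling a rational polynomial to have value `1` at `1`. -/
noncomputable def unitAtOne (q : ℚ[X]) : ℝ[X] :=
  C ((q.eval 1 : ℚ) : ℝ)⁻¹ * q.map (algebraMap ℚ ℝ)

theorem unitAtOne_mul (p q : ℚ[X]) : unitAtOne (p * q) = unitAtOne p * unitAtOne q := by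
  simp only [unitAtOne, eval_mul, Rat.cast_mul, mul_inv, C_mul, Polynomial.map_mul]
  ring

theorem unitAtOne_coeff (q : ℚ[X]) (k : ℕ) :
    (unitAtOne q).coeff k = ((q.eval 1)⁻¹ * q.coeff k : ℚ) := by
  simp [unitAtOne]

theorem unitAtOne_eval (q : ℚ[X]) (x : ℝ) :
    (unitAtOne q).eval x = ((q.eval 1 : ℚ) : ℝ)⁻¹ * aeval x q := by
  simp [unitAtOne, eval_map_algebraMap]

theorem aeval_one_eq (q : ℚ[X]) : aeval (1 : ℝ) q = ((q.eval 1 : ℚ) : ℝ) := by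
  simpa using aeval_algebraMap_apply_eq_algebraMap_eval (A := ℝ) (1 : ℚ) q

namespace MonicNonnegFactor

theorem eval_one_pos {q : ℚ[X]} (hq : MonicNonnegFactor q) : 0 < q.eval 1 := by
  have h := eval_pos hq one_pos
  rw [aeval_one_eq] at h
  exact_mod_cast h

theorem unitAtOne_mem {q : ℚ[X]} (hq : MonicNonnegFactor q) : unitAtOne q ∈ MQset := by
  have h1 : (0 : ℝ) < (q.eval 1 : ℚ) := by exact_mod_cast hq.eval_one_pos
  refine ⟨⟨?_, fun x hx => ?_⟩, fun k => ⟨_, unitAtOne_coeff q k⟩⟩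
  · rw [unitAtOne_eval, aeval_one_eq, inv_mul_cancel₀ h1.ne']
  · rw [unitAtOne_eval]
    exact mul_pos (inv_pos.2 h1) (hq.eval_pos hx)

theorem degree_unitAtOne {q : ℚ[X]} (hq : MonicNonnegFactor q) :
    (unitAtOne q).degree = q.degree := by
  have h1 : ((q.eval 1 : ℚ) : ℝ)⁻¹ ≠ 0 := by
    exact_mod_cast inv_ne_zero hq.eval_one_pos.ne'
  rw [unitAtOne, degree_C_mul h1, degree_map]

end MonicNonnegFactor

theorem MonicNonneg.unitAtOne_mem {p : ℚ[X]} (hp : MonicNonneg p) :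
    unitAtOne p ∈ PQset := by
  have h := hp.mem_factor.unitAtOne_mem
  refine ⟨⟨fun k => ?_, h.1.1⟩, h.2⟩
  rw [unitAtOne_coeff]
  exact_mod_cast mul_nonneg (inv_nonneg.2 hp.mem_factor.eval_one_pos.le) (hp.2 k)

theorem eq_of_associated_of_eval_one {p q : ℝ[X]} (h : Associated p q) (hp : p.eval 1 = 1)
    (hq : q.eval 1 = 1) : p = q := by
  obtain ⟨u, rfl⟩ := h
  obtain ⟨r, -, hr⟩ := isUnit_iff.1 u.isUnit
  rw [← hr, eval_mul, hp, eval_C, one_mul] at hq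
  rw [← hr, hq, C_1, mul_one]

theorem supportMap_normalize {Ψ : ℝ[X] → ℝ[X]}
    (hmul : ∀ p ∈ MQset, ∀ q ∈ MQset, Ψ (p * q) = Ψ p * Ψ q)
    (hdeg : ∀ q ∈ MQset, (Ψ q).degree = q.degree)
    (hmapP : ∀ p ∈ PQset, Ψ p ∈ Pset)
    (hsupp : ∀ p ∈ PQset, ∀ k : ℕ, 0 < (Ψ p).coeff k ↔ 0 < p.coeff k)
    (hfix : Ψ (lin 1) = lin 1) : SupportMap fun q => normalize (Ψ (unitAtOne q)) where
  mul q hq r hr := by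
    rw [unitAtOne_mul, hmul _ hq.unitAtOne_mem _ hr.unitAtOne_mem, normalize_mul]
  monic q hq := by
    refine monic_normalize fun h => hq.1.ne_zero ?_
    rw [← degree_eq_bot, ← hq.degree_unitAtOne, ← hdeg _ hq.unitAtOne_mem, h, degree_zero]
  natDegree q hq := by
    apply natDegree_eq_of_degree_eq
    rw [degree_normalize, hdeg _ hq.unitAtOne_mem, hq.degree_unitAtOne]
  coeff_eq_zero p hp k hk := by
    have hP := hp.unitAtOne_mem
    have h0 : (Ψ (unitAtOne p)).coeff k = 0 := by
      refine le_antisymm (not_lt.1 fun h => ?_) ((hmapP _ hP).1 k)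
      rw [hsupp _ hP, unitAtOne_coeff, hk] at h
      simp at h
    rw [normalize_apply, coe_normUnit, coeff_mul_C, h0, zero_mul]
  X_add_one := by
    have h : unitAtOne (X + C 1) = lin 1 := by
      simp [unitAtOne, lin]
    rw [h, hfix, lin, normalize_mul, (monic_X_add_C 1).normalize_eq_self,
      normalize_eq_one.2 (isUnit_C.2 (by norm_num)), one_mul]

theorem stmt_19 (Ψ : Polynomial ℝ → Polynomial ℝ)
    (hmapM : ∀ q ∈ MQset, Ψ q ∈ Mset)
    (hmul : ∀ p ∈ MQset, ∀ q ∈ MQset, Ψ (p * q) = Ψ p * Ψ q)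
    (hdeg : ∀ q ∈ MQset, (Ψ q).degree = q.degree)
    (hmapP : ∀ p ∈ PQset, Ψ p ∈ Pset)
    (hsupp : ∀ p ∈ PQset, ∀ k : ℕ, 0 < (Ψ p).coeff k ↔ 0 < p.coeff k)
    (hfix : Ψ (lin 1) = lin 1) :
    ∀ a : ℚ, (a : ℝ) ∈ Set.Ioo (-2 : ℝ) 2 → ∀ γ : ℚ, 0 < γ →
      Ψ (C (1 - (a : ℝ) * (γ : ℝ) + (γ : ℝ) ^ 2)⁻¹ *
          (X ^ 2 - C ((a : ℝ) * (γ : ℝ)) * X + C ((γ : ℝ) ^ 2))) =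
        C (1 - (a : ℝ) * (γ : ℝ) + (γ : ℝ) ^ 2)⁻¹ *
          (X ^ 2 - C ((a : ℝ) * (γ : ℝ)) * X + C ((γ : ℝ) ^ 2)) := by
  intro a ha γ hγ
  have ha2 : a ^ 2 < 4 := by
    have h1 : (-2 : ℚ) < a := by exact_mod_cast ha.1
    have h2 : a < 2 := by exact_mod_cast ha.2
    nlinarith
  obtain ⟨hq, hfixed⟩ := quad_mem_and_fixed (s := -(a * γ)) (c := γ ^ 2)
    (by nlinarith [sq_pos_of_pos hγ])
  have h := hfixed _ (supportMap_normalize hmul hdeg hmapP hsupp hfix)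
  have hunit : unitAtOne (quad (-(a * γ)) (γ ^ 2)) =
      C (1 - (a : ℝ) * (γ : ℝ) + (γ : ℝ) ^ 2)⁻¹ *
        (X ^ 2 - C ((a : ℝ) * (γ : ℝ)) * X + C ((γ : ℝ) ^ 2)) := by
    simp [unitAtOne, quad, sub_eq_add_neg]
  rw [← hunit]
  have hM := hq.unitAtOne_mem
  have hc : ((eval 1 (quad (-(a * γ)) (γ ^ 2)) : ℚ) : ℝ)⁻¹ ≠ 0 := by
    exact_mod_cast inv_ne_zero hq.eval_one_pos.ne'
  have hreal : unitAtOne (quad (-(a * γ)) (γ ^ 2)) =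
      C ((eval 1 (quad (-(a * γ)) (γ ^ 2)) : ℚ) : ℝ)⁻¹ *
        quad ((-(a * γ) : ℚ) : ℝ) ((γ ^ 2 : ℚ) : ℝ) := by
    simp [unitAtOne, quad]
  have hM := hq.unitAtOne_mem
  refine eq_of_associated_of_eval_one ?_ (hmapM _ hM).1 hM.1.1
  rw [← normalize_associated_iff, h]
  conv_rhs => rw [hreal]
  exact associated_unit_mul_right _ _ (isUnit_C.2 hc.isUnit)
end
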